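/- arXiv:2508.13254 — 3 statements merged into one kernel-verified Lean document; each statement's English description precedes it below -/
import Mathlib

section
/- For every s ∈ ℂ with Re(s) > 2, the double series (1−q)² Σ_{0<m₁<m₂} q^{−m₁+(s−1)m₂} / ( ((1−q^{m₂})² − (1−q^{m₁})(1−q^{m₂})q^{m₂−m₁}) · [m₂]_q^{s−2} ) converges absolutely and equals Σ_{m=1}^∞ (q^{(s−2)m}/[m]_q^{s−1}) · (Σ_{j=1}^{m−1} q^j/[j]_q). -/
open Complex

/-- The `q`-analogue `[n]_q = (1 - q^n)/(1 - q)` of a natural number `n`. -/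
noncomputable def qnum (q : ℝ) (n : ℕ) : ℝ := (1 - q ^ n) / (1 - q)

lemma one_le_qnum {q : ℝ} (hq0 : 0 < q) (hq1 : q < 1) {n : ℕ} (hn : 0 < n) : 1 ≤ qnum q n := by
  rw [qnum, le_div_iff₀ (by linarith)]
  have := pow_le_of_le_one hq0.le hq1.le hn.ne'
  linarith

/-- The double series, reindexed by `j = m₂ - m₁`, splits as a product of a factor in `m₂` and a
factor in `j`. -/
lemma double_series_term_eq {q : ℝ} (hq0 : 0 < q) (hq1 : q < 1) (s : ℂ) {m j : ℕ}
    (hj : 1 ≤ j) (hjm : j ≤ m) :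
    (((1 - q) ^ 2 : ℝ) : ℂ) * (q : ℂ) ^ (-((m + 1 - j : ℕ) : ℂ) + (s - 1) * (m + 1 : ℕ)) /
        ((((1 - q ^ (m + 1)) ^ 2 -
          (1 - q ^ (m + 1 - j)) * (1 - q ^ (m + 1)) * q ^ (m + 1 - (m + 1 - j)) : ℝ) : ℂ) *
          (qnum q (m + 1) : ℂ) ^ (s - 2)) =
      (q : ℂ) ^ ((s - 2) * (m + 1 : ℕ)) / (qnum q (m + 1) : ℂ) ^ (s - 1) *
        ((q ^ j / qnum q j : ℝ) : ℂ) := by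
  have hq : (q : ℂ) ≠ 0 := by exact_mod_cast hq0.ne'
  have hQ : (qnum q (m + 1) : ℂ) ≠ 0 := by
    exact_mod_cast (zero_lt_one.trans_le (one_le_qnum hq0 hq1 m.succ_pos)).ne'
  have hden : (1 - q ^ (m + 1)) ^ 2 -
      (1 - q ^ (m + 1 - j)) * (1 - q ^ (m + 1)) * q ^ (m + 1 - (m + 1 - j)) =
      (1 - q) ^ 2 * (qnum q (m + 1) * qnum q j) := by
    have h1 : 1 - q ≠ 0 := by linarith
    have h2 : m + 1 - (m + 1 - j) = j := by omega
    have h3 : q ^ (m + 1) = q ^ (m + 1 - j) * q ^ j := by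
      rw [← pow_add]; congr 1; omega
    rw [h2, qnum, qnum]
    field_simp
    rw [h3]
    ring
  have hexp : -((m + 1 - j : ℕ) : ℂ) + (s - 1) * (m + 1 : ℕ) =
      (s - 2) * (m + 1 : ℕ) + (j : ℕ) := by
    rw [Nat.cast_sub (by omega)]
    ring
  have hpow : (qnum q (m + 1) : ℂ) ^ (s - 1) =
      (qnum q (m + 1) : ℂ) ^ (s - 2) * (qnum q (m + 1) : ℂ) := by
    rw [show s - 1 = s - 2 + 1 by ring, Complex.cpow_add _ _ hQ, Complex.cpow_one]
  have h1 : (((1 - q) ^ 2 : ℝ) : ℂ) ≠ 0 := by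
    exact_mod_cast pow_ne_zero 2 (by linarith : (1 - q) ≠ 0)
  rw [hden, hexp, Complex.cpow_add _ _ hq, Complex.cpow_natCast, hpow, Complex.ofReal_mul, mul_assoc,
    mul_div_mul_left _ _ h1, Complex.ofReal_mul, Complex.ofReal_div, Complex.ofReal_pow,
    div_mul_div_comm]
  congr 1
  ring

lemma norm_split_term_le {q : ℝ} (hq0 : 0 < q) (hq1 : q < 1) {s : ℂ} (hs : 2 < s.re) {m j : ℕ}
    (hj : 1 ≤ j) :
    ‖(q : ℂ) ^ ((s - 2) * (m + 1 : ℕ)) / (qnum q (m + 1) : ℂ) ^ (s - 1) *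
        ((q ^ j / qnum q j : ℝ) : ℂ)‖ ≤ (q ^ (s.re - 2)) ^ m * q ^ j := by
  have hQ := one_le_qnum hq0 hq1 m.succ_pos
  have hJ := one_le_qnum hq0 hq1 hj
  have hr1 : q ^ (s.re - 2) ≤ 1 := Real.rpow_le_one hq0.le hq1.le (by linarith)
  have hr0 : 0 < q ^ (s.re - 2) := Real.rpow_pos_of_pos hq0 _
  have hre : ((s - 2) * ((m + 1 : ℕ) : ℂ)).re = (s.re - 2) * (m + 1 : ℕ) := by
    simp [-Nat.cast_add]
  have hre1 : (s - 1).re = s.re - 1 := by simp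
  rw [norm_mul, norm_div, Complex.norm_cpow_eq_rpow_re_of_pos hq0,
    Complex.norm_cpow_eq_rpow_re_of_pos (by linarith), hre, hre1, Real.rpow_mul_natCast hq0.le,
    Complex.norm_real, Real.norm_of_nonneg (by positivity)]
  gcongr
  · exact (div_le_self (by positivity) (Real.one_le_rpow hQ (by linarith))).trans
      (pow_le_pow_of_le_one hr0.le hr1 m.le_succ)
  · exact div_le_self (by positivity) hJ

/-- Pairs `0 < m₁ < m₂`, reindexed by `m₂ = m + 1` and `m₁ = m + 1 - j` with `1 ≤ j ≤ m`. -/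
def sigmaIccEquivPairs :
    (Σ m : ℕ, Finset.Icc 1 m) ≃ {p : ℕ × ℕ // 0 < p.1 ∧ p.1 < p.2} where
  toFun x := ⟨(x.1 + 1 - x.2, x.1 + 1), by
    have := Finset.mem_Icc.1 x.2.2
    exact ⟨by dsimp only; omega, by dsimp only; omega⟩⟩
  invFun p := ⟨p.1.2 - 1, p.1.2 - p.1.1, by
    have := p.2
    exact Finset.mem_Icc.2 ⟨by omega, by omega⟩⟩
  left_inv x := by
    have := Finset.mem_Icc.1 x.2.2
    refine Sigma.subtype_ext ?_ ?_ <;> dsimp only <;> omega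
  right_inv p := by
    have := p.2
    ext <;> dsimp only <;> omega

lemma summable_split_term {q : ℝ} (hq0 : 0 < q) (hq1 : q < 1) {s : ℂ} (hs : 2 < s.re) :
    Summable (fun x : Σ m : ℕ, Finset.Icc 1 m =>
      (q : ℂ) ^ ((s - 2) * (x.1 + 1 : ℕ)) / (qnum q (x.1 + 1) : ℂ) ^ (s - 1) *
        ((q ^ (x.2 : ℕ) / qnum q x.2 : ℝ) : ℂ)) := by
  have hr1 : q ^ (s.re - 2) < 1 := Real.rpow_lt_one hq0.le hq1 (by linarith)
  have hprod : Summable (fun p : ℕ × ℕ => (q ^ (s.re - 2)) ^ p.1 * q ^ p.2) :=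
    (summable_geometric_of_lt_one (by positivity) hr1).mul_of_nonneg
      (summable_geometric_of_lt_one hq0.le hq1) (fun _ => by positivity) (fun _ => by positivity)
  have hinj : Function.Injective
      (fun x : Σ m : ℕ, Finset.Icc 1 m => ((x.1, (x.2 : ℕ)) : ℕ × ℕ)) := fun x y h =>
    Sigma.subtype_ext (congrArg Prod.fst h) (congrArg Prod.snd h)
  exact Summable.of_norm_bounded (hprod.comp_injective hinj)
    fun x => norm_split_term_le hq0 hq1 hs (Finset.mem_Icc.1 x.2.2).1

/-- For `Re(s) > 2`, the double series
`(1−q)² Σ_{0<m₁<m₂} q^{−m₁+(s−1)m₂}/(((1−q^{m₂})² − (1−q^{m₁})(1−q^{m₂})q^{m₂−m₁})·[m₂]_q^{s−2})`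
converges absolutely and equals
`Σ_{m=1}^∞ (q^{(s−2)m}/[m]_q^{s−1})·(Σ_{j=1}^{m−1} q^j/[j]_q)`. -/
theorem second_double_series_evaluation (q : ℝ) (hq0 : 0 < q) (hq1 : q < 1)
    (s : ℂ) (hs : 2 < s.re) :
    Summable (fun p : {p : ℕ × ℕ // 0 < p.1 ∧ p.1 < p.2} =>
      (((1 - q) ^ 2 : ℝ) : ℂ) * (q : ℂ) ^ (-(p.1.1 : ℂ) + (s - 1) * p.1.2) /
        ((((1 - q ^ p.1.2) ^ 2 - (1 - q ^ p.1.1) * (1 - q ^ p.1.2) * q ^ (p.1.2 - p.1.1) : ℝ) : ℂ) *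
          (qnum q p.1.2 : ℂ) ^ (s - 2))) ∧
    Summable (fun m : ℕ =>
      (q : ℂ) ^ ((s - 2) * (m + 1 : ℕ)) / (qnum q (m + 1) : ℂ) ^ (s - 1) *
        ((∑ j ∈ Finset.Icc 1 m, q ^ j / qnum q j : ℝ) : ℂ)) ∧
    ∑' p : {p : ℕ × ℕ // 0 < p.1 ∧ p.1 < p.2},
        (((1 - q) ^ 2 : ℝ) : ℂ) * (q : ℂ) ^ (-(p.1.1 : ℂ) + (s - 1) * p.1.2) /
          ((((1 - q ^ p.1.2) ^ 2 - (1 - q ^ p.1.1) * (1 - q ^ p.1.2) * q ^ (p.1.2 - p.1.1) : ℝ) : ℂ) *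
            (qnum q p.1.2 : ℂ) ^ (s - 2)) =
      ∑' m : ℕ, (q : ℂ) ^ ((s - 2) * (m + 1 : ℕ)) / (qnum q (m + 1) : ℂ) ^ (s - 1) *
        ((∑ j ∈ Finset.Icc 1 m, q ^ j / qnum q j : ℝ) : ℂ) := by
  have hsum := summable_split_term hq0 hq1 hs
  have hterm (x : Σ m : ℕ, Finset.Icc 1 m) :=
    double_series_term_eq hq0 hq1 s (Finset.mem_Icc.1 x.2.2).1 (Finset.mem_Icc.1 x.2.2).2
  have hinner (m : ℕ) : ∑' j : Finset.Icc 1 m,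
      (q : ℂ) ^ ((s - 2) * (m + 1 : ℕ)) / (qnum q (m + 1) : ℂ) ^ (s - 1) *
        ((q ^ (j : ℕ) / qnum q j : ℝ) : ℂ) =
      (q : ℂ) ^ ((s - 2) * (m + 1 : ℕ)) / (qnum q (m + 1) : ℂ) ^ (s - 1) *
        ((∑ j ∈ Finset.Icc 1 m, q ^ j / qnum q j : ℝ) : ℂ) := by
    rw [tsum_mul_left, Complex.ofReal_sum]
    congr 1
    exact Finset.tsum_subtype (Finset.Icc 1 m) fun j => ((q ^ j / qnum q j : ℝ) : ℂ)
  refine ⟨?_, ?_, ?_⟩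
  · rw [← sigmaIccEquivPairs.summable_iff]
    exact hsum.congr fun x => (hterm x).symm
  · exact hsum.sigma.congr hinner
  · rw [← sigmaIccEquivPairs.tsum_eq]
    refine (tsum_congr hterm).trans ?_
    rw [hsum.tsum_sigma]
    exact tsum_congr hinner
end

section
/- Let m₁ be a positive integer and α ∈ ℂ. Then Σ_{m₂=m₁+1}^∞ ∫₀^{q^{m₂−1}} ([m₂]_q − t)^{−α} dt = ∫_{[m₁]_q}^{1/(1−q)} u^{−α} du, both the series and the integrals being convergent. -/
open Complex MeasureTheory

/-- Over the consecutive pieces cut out by a monotone sequence converging to `L`, the partial sums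
of the integrals of an interval integrable function tend to the integral over the whole interval. -/
theorem tendsto_sum_integral_adjacent_of_monotone {E : Type*} [NormedAddCommGroup E]
    [NormedSpace ℝ E] {f : ℝ → E} {a : ℕ → ℝ} {L : ℝ} (ha : Monotone a)
    (hL : Filter.Tendsto a Filter.atTop (nhds L)) (hf : IntervalIntegrable f volume (a 0) L) :
    Filter.Tendsto (fun n => ∑ k ∈ Finset.range n, ∫ x in a k..a (k + 1), f x) Filter.atTop
      (nhds (∫ x in a 0..L, f x)) := by
  have haL (n : ℕ) : a n ≤ L := ha.ge_of_tendsto hL n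
  have hmem (n : ℕ) : a n ∈ Set.uIcc (a 0) L := by
    rw [Set.uIcc_of_le (haL 0)]
    exact ⟨ha n.zero_le, haL n⟩
  have hsum (n : ℕ) : ∑ k ∈ Finset.range n, ∫ x in a k..a (k + 1), f x = ∫ x in a 0..a n, f x :=
    intervalIntegral.sum_integral_adjacent_intervals fun k _ =>
      hf.mono_set (Set.uIcc_subset_uIcc (hmem k) (hmem (k + 1)))
  simp only [hsum]
  have hcont := intervalIntegral.continuousOn_primitive_interval' hf Set.left_mem_uIcc
  exact (hcont L Set.right_mem_uIcc).tendsto.comp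
    (tendsto_nhdsWithin_iff.mpr ⟨hL, Filter.Eventually.of_forall hmem⟩)

/-- The integrals of an interval integrable function over the consecutive pieces cut out by a
monotone sequence converging to `L` add up to the integral over the whole interval. -/
theorem hasSum_integral_adjacent_of_monotone {E : Type*} [NormedAddCommGroup E] [NormedSpace ℝ E]
    [CompleteSpace E] {f : ℝ → E} {a : ℕ → ℝ} {L : ℝ} (ha : Monotone a)
    (hL : Filter.Tendsto a Filter.atTop (nhds L)) (hf : IntervalIntegrable f volume (a 0) L) :
    HasSum (fun n => ∫ x in a n..a (n + 1), f x) (∫ x in a 0..L, f x) := by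
  have hle (n : ℕ) : a n ≤ a (n + 1) := ha n.le_succ
  have hnorm : Summable fun n => ∫ x in a n..a (n + 1), ‖f x‖ :=
    ((hasSum_iff_tendsto_nat_of_nonneg (fun n =>
      intervalIntegral.integral_nonneg (hle n) fun x _ => norm_nonneg (f x)) _).mpr
        (tendsto_sum_integral_adjacent_of_monotone ha hL hf.norm)).summable
  have hsummable : Summable fun n => ∫ x in a n..a (n + 1), f x :=
    hnorm.of_norm_bounded fun n => intervalIntegral.norm_integral_le_integral_norm (hle n)
  exact hsummable.hasSum_iff_tendsto_nat.mpr (tendsto_sum_integral_adjacent_of_monotone ha hL hf)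

theorem qnum_succ {q : ℝ} (hq : q ≠ 1) (n : ℕ) : qnum q (n + 1) = qnum q n + q ^ n := by
  have h : 1 - q ≠ 0 := sub_ne_zero.mpr hq.symm
  simp only [qnum]
  field_simp
  ring

theorem qnum_monotone {q : ℝ} (hq0 : 0 ≤ q) (hq1 : q ≠ 1) : Monotone (qnum q) :=
  monotone_nat_of_le_succ fun n => by
    rw [qnum_succ hq1]
    exact le_add_of_nonneg_right (pow_nonneg hq0 n)

theorem qnum_pos {q : ℝ} (hq0 : 0 ≤ q) (hq1 : q < 1) {n : ℕ} (hn : 0 < n) : 0 < qnum q n :=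
  div_pos (sub_pos.mpr (pow_lt_one₀ hq0 hq1 hn.ne')) (sub_pos.mpr hq1)

theorem tendsto_qnum {q : ℝ} (hq0 : 0 ≤ q) (hq1 : q < 1) :
    Filter.Tendsto (qnum q) Filter.atTop (nhds (1 / (1 - q))) := by
  have h := ((tendsto_pow_atTop_nhds_zero_of_lt_one hq0 hq1).const_sub 1).div_const (1 - q)
  rwa [sub_zero] at h

theorem intervalIntegrable_ofReal_cpow_of_pos {a b : ℝ} (ha : 0 < a) (hab : a ≤ b) (s : ℂ) :
    IntervalIntegrable (fun u : ℝ => (u : ℂ) ^ s) volume a b :=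
  intervalIntegral.intervalIntegrable_cpow (Or.inr fun h => by
    rw [Set.uIcc_of_le hab] at h
    exact ha.not_ge h.1)

/-- For a positive integer `m₁` and `α ∈ ℂ`,
`Σ_{m₂=m₁+1}^∞ ∫₀^{q^{m₂−1}} ([m₂]_q − t)^{−α} dt = ∫_{[m₁]_q}^{1/(1−q)} u^{−α} du`,
both the series and the integrals being convergent.  Here the series index `m₂ = m₁+1+m`
with `m` ranging over `ℕ`. -/
theorem integral_telescoping_series (q : ℝ) (hq0 : 0 < q) (hq1 : q < 1)
    (m₁ : ℕ) (hm₁ : 0 < m₁) (α : ℂ) :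
    (∀ m : ℕ, IntervalIntegrable
      (fun t : ℝ => ((qnum q (m₁ + m + 1) - t : ℝ) : ℂ) ^ (-α))
      volume 0 (q ^ (m₁ + m))) ∧
    IntervalIntegrable (fun u : ℝ => (u : ℂ) ^ (-α)) volume (qnum q m₁) (1 / (1 - q)) ∧
    HasSum
      (fun m : ℕ => ∫ t in (0 : ℝ)..(q ^ (m₁ + m)),
        ((qnum q (m₁ + m + 1) - t : ℝ) : ℂ) ^ (-α))
      (∫ u in (qnum q m₁ : ℝ)..(1 / (1 - q)), (u : ℂ) ^ (-α)) := by
  have hmono := qnum_monotone hq0.le hq1.ne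
  have hlim := tendsto_qnum hq0.le hq1
  have hpos (m : ℕ) : 0 < qnum q (m₁ + m) := qnum_pos hq0.le hq1 (by omega)
  have hdiff (m : ℕ) : qnum q (m₁ + m + 1) - q ^ (m₁ + m) = qnum q (m₁ + m) := by
    rw [qnum_succ hq1.ne, add_sub_cancel_right]
  have hint : IntervalIntegrable (fun u : ℝ => (u : ℂ) ^ (-α)) volume (qnum q m₁) (1 / (1 - q)) :=
    intervalIntegrable_ofReal_cpow_of_pos (hpos 0) (hmono.ge_of_tendsto hlim m₁) (-α)
  refine ⟨fun m => ?_, hint, ?_⟩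
  · have h := (intervalIntegrable_ofReal_cpow_of_pos (hpos m) (hmono (m₁ + m).le_succ)
      (-α)).symm.comp_sub_left (qnum q (m₁ + m + 1))
    simpa [qnum_succ hq1.ne] using h
  · have h := hasSum_integral_adjacent_of_monotone (a := fun m => qnum q (m₁ + m))
      (fun i j hij => hmono (by omega))
      (hlim.comp (Filter.tendsto_atTop_mono (fun m => Nat.le_add_left m m₁) Filter.tendsto_id))
      hint
    have hterm (m : ℕ) : ∫ t in (0 : ℝ)..(q ^ (m₁ + m)),
        ((qnum q (m₁ + m + 1) - t : ℝ) : ℂ) ^ (-α) =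
        ∫ u in (qnum q (m₁ + m))..(qnum q (m₁ + (m + 1))), (u : ℂ) ^ (-α) := by
      rw [intervalIntegral.integral_comp_sub_left (fun u : ℝ => (u : ℂ) ^ (-α)), sub_zero, hdiff,
        add_assoc]
    simp only [hterm]
    exact h
end

section
/- Let d be a positive integer, D a non-negative integer, and s ∈ ℂ with Re(s) > d+2. Then F_q^{(1)}(D;s;d) = Σ_{t>D} (q^{(s−d−2)t}/[t]_q^{s−d−1}) · Σ_{0<n₀≤n₁≤⋯≤n_d≤n₀+t} q^{n₀+n₁+⋯+n_d}/([n₀]_q[n₁]_q⋯[n_d]_q), all series converging absolutely. -/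
open Complex

/-- The product `∏_i q^{n_i}/[n_i]_q` over a chain `n₁ ≤ ⋯ ≤ n_d`. -/
noncomputable def chainProd (q : ℝ) {d : ℕ} (n : Fin d → ℕ) : ℂ :=
  ∏ i, ((q : ℂ) ^ (n i) / (qnum q (n i) : ℂ))

/-- The index set for `F_q^{(0)}(D;s;d)`: pairs of `m > D` and chains
`m − D ≤ n₁ ≤ ⋯ ≤ n_d ≤ m`. -/
def F0Idx (D d : ℕ) : Type :=
  {p : ℕ × (Fin d → ℕ) // D < p.1 ∧ Monotone p.2 ∧ ∀ i, p.1 - D ≤ p.2 i ∧ p.2 i ≤ p.1}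

/-- The general term of the series `F_q^{(0)}(D;s;d)`. -/
noncomputable def F0term (q : ℝ) (d : ℕ) (s : ℂ) (p : ℕ × (Fin d → ℕ)) : ℂ :=
  ((q : ℂ) ^ ((s - (d : ℂ) - 1) * (p.1 : ℂ)) / (qnum q p.1 : ℂ) ^ (s - (d : ℂ))) *
    chainProd q p.2

/-- The index set for `F_q^{(1)}, F_q^{(2)}, F_q^{(3)}`: triples of `D < t < m` and chains
`m − t ≤ n₁ ≤ ⋯ ≤ n_d ≤ m`. -/
def FIdx (D d : ℕ) : Type :=
  {p : ℕ × ℕ × (Fin d → ℕ) // D < p.1 ∧ p.1 < p.2.1 ∧ Monotone p.2.2 ∧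
    ∀ i, p.2.1 - p.1 ≤ p.2.2 i ∧ p.2.2 i ≤ p.2.1}

/-- The general term of the series `F_q^{(1)}(D;s;d)`. -/
noncomputable def F1term (q : ℝ) (d : ℕ) (s : ℂ) (p : ℕ × ℕ × (Fin d → ℕ)) : ℂ :=
  ((q : ℂ) ^ ((s - (d : ℂ) - 2) * (p.1 : ℂ)) * (q : ℂ) ^ (p.2.1 - p.1) /
      ((qnum q p.1 : ℂ) ^ (s - (d : ℂ) - 1) * (qnum q (p.2.1 - p.1) : ℂ))) *
    chainProd q p.2.2

/-- The general term of the series `F_q^{(2)}(D;s;d)`. -/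
noncomputable def F2term (q : ℝ) (d : ℕ) (s : ℂ) (p : ℕ × ℕ × (Fin d → ℕ)) : ℂ :=
  ((q : ℂ) ^ ((s - (d : ℂ) - 2) * (p.2.1 : ℂ)) * (q : ℂ) ^ (p.2.1) /
      ((qnum q p.1 : ℂ) ^ (s - (d : ℂ) - 1) * (qnum q p.2.1 : ℂ))) *
    chainProd q p.2.2

/-- The general term of the series `F_q^{(3)}(D;s;d)`. -/
noncomputable def F3term (q : ℝ) (d : ℕ) (s : ℂ) (p : ℕ × ℕ × (Fin d → ℕ)) : ℂ :=
  ((q : ℂ) ^ ((s - (d : ℂ) - 2) * (p.2.1 : ℂ)) * (q : ℂ) ^ (p.2.1 - p.1) /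
      ((qnum q p.2.1 : ℂ) ^ (s - (d : ℂ) - 1) * (qnum q (p.2.1 - p.1) : ℂ))) *
    chainProd q p.2.2

/-- The index set of the inner series in the rewriting of `F_q^{(1)}(D;s;d)`:
chains `0 < n₀ ≤ n₁ ≤ ⋯ ≤ n_d ≤ n₀ + t`. -/
def F1InnerIdx (t d : ℕ) : Type :=
  {n : Fin (d + 1) → ℕ // Monotone n ∧ 0 < n 0 ∧ n (Fin.last d) ≤ n 0 + t}

lemma chainProd_cons (q : ℝ) {d : ℕ} (n : Fin (d + 1) → ℕ) :
    chainProd q n = (q : ℂ) ^ (n 0) / (qnum q (n 0) : ℂ) * chainProd q (Fin.tail n) := by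
  simp only [chainProd, Fin.prod_univ_succ, Fin.tail]

lemma norm_chainProd_le {q : ℝ} (hq0 : 0 < q) (hq1 : q < 1) {d : ℕ} {n : Fin d → ℕ}
    (hn : ∀ i, 0 < n i) : ‖chainProd q n‖ ≤ ∏ i, q ^ n i := by
  rw [chainProd, norm_prod]
  refine Finset.prod_le_prod (fun i _ => norm_nonneg _) fun i _ => ?_
  have h1 := one_le_qnum hq0 hq1 (hn i)
  rw [norm_div, norm_pow, Complex.norm_real, Complex.norm_real, Real.norm_of_nonneg hq0.le,
    Real.norm_of_nonneg (by linarith)]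
  exact div_le_self (by positivity) h1

/-- The modulus of `q^{(s-d-2)t}/[t]_q^{s-d-1}` decays geometrically in `t`. -/
lemma norm_coeff_le {q : ℝ} (hq0 : 0 < q) (hq1 : q < 1) {d : ℕ} {s : ℂ}
    (hs : (d : ℝ) + 2 < s.re) {t : ℕ} (ht : 0 < t) :
    ‖(q : ℂ) ^ ((s - (d : ℂ) - 2) * (t : ℂ)) / (qnum q t : ℂ) ^ (s - (d : ℂ) - 1)‖ ≤
      (q ^ (s.re - d - 2)) ^ t := by
  have h1 := one_le_qnum hq0 hq1 ht
  rw [norm_div, Complex.norm_cpow_eq_rpow_re_of_pos hq0,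
    Complex.norm_cpow_eq_rpow_re_of_pos (by linarith), ← Real.rpow_natCast (q ^ _) t,
    ← Real.rpow_mul hq0.le]
  have e : ((s - (d : ℂ) - 2) * (t : ℂ)).re = (s.re - d - 2) * t := by simp
  rw [e]
  refine div_le_self (by positivity) (Real.one_le_rpow h1 ?_)
  simp only [Complex.sub_re, Complex.natCast_re, Complex.one_re]
  linarith

lemma summable_prod_apply {f : ℕ → ℝ} (hf : Summable f) (hf0 : ∀ n, 0 ≤ f n) (k : ℕ) :
    Summable fun n : Fin k → ℕ => ∏ i, f (n i) := by
  induction k with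
  | zero => exact Summable.of_finite
  | succ k ih =>
    rw [← (Fin.consEquiv fun _ : Fin (k + 1) => ℕ).summable_iff]
    refine (hf.mul_of_nonneg ih hf0 fun n => Finset.prod_nonneg fun i _ => hf0 _).congr ?_
    intro p
    simp [Fin.consEquiv, Fin.prod_univ_succ]

lemma F1InnerIdx.pos {t d : ℕ} (n : F1InnerIdx t d) (i : Fin (d + 1)) : 0 < n.1 i :=
  n.2.2.1.trans_le (n.2.1 (Fin.zero_le i))

/-- The substitution `m = n₀ + t`. -/
def F1IdxEquiv (D d : ℕ) : (Σ t : {t : ℕ // D < t}, F1InnerIdx t.1 d) ≃ FIdx D d where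
  toFun x := ⟨(x.1.1, x.2.1 0 + x.1.1, Fin.tail x.2.1), x.1.2,
    Nat.lt_add_of_pos_left x.2.2.2.1, fun _ _ h => x.2.2.1 (Fin.succ_le_succ_iff.2 h), fun i =>
      ⟨by simpa [Fin.tail] using x.2.2.1 (Fin.zero_le i.succ),
        (x.2.2.1 (Fin.le_last i.succ)).trans x.2.2.2.2⟩⟩
  invFun p := ⟨⟨p.1.1, p.2.1⟩, Fin.cons (p.1.2.1 - p.1.1) p.1.2.2, by
    obtain ⟨⟨t, m, n⟩, hD, htm, hn, hb⟩ := p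
    dsimp only at hD htm hn hb ⊢
    refine ⟨?_, by simpa using htm, ?_⟩
    · intro i j hij
      induction i using Fin.cases with
      | zero =>
        induction j using Fin.cases with
        | zero => exact le_rfl
        | succ j => simpa using (hb j).1
      | succ i =>
        induction j using Fin.cases with
        | zero => exact absurd hij (by simp)
        | succ j => simpa using hn (Fin.succ_le_succ_iff.1 hij)
    · have : ∀ j, (Fin.cons (m - t) n : Fin (d + 1) → ℕ) j ≤ m := by
        intro j
        induction j using Fin.cases with
        | zero => simp
        | succ j => simpa using (hb j).2
      have h := this (Fin.last d)
      simp only [Fin.cons_zero]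
      omega⟩
  left_inv x := by
    obtain ⟨t, n, hn⟩ := x
    simp [Fin.cons_self_tail]
  right_inv p := by
    obtain ⟨⟨t, m, n⟩, hD, htm, hn, hb⟩ := p
    apply Subtype.ext
    dsimp only at htm ⊢
    simp [Nat.sub_add_cancel htm.le]

lemma F1term_F1IdxEquiv (q : ℝ) (D d : ℕ) (s : ℂ)
    (x : Σ t : {t : ℕ // D < t}, F1InnerIdx t.1 d) :
    F1term q d s (F1IdxEquiv D d x).1 =
      ((q : ℂ) ^ ((s - (d : ℂ) - 2) * (x.1.1 : ℂ)) / (qnum q x.1.1 : ℂ) ^ (s - (d : ℂ) - 1)) *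
        chainProd q x.2.1 := by
  have h : (F1IdxEquiv D d x).1 = (x.1.1, x.2.1 0 + x.1.1, Fin.tail x.2.1) := rfl
  rw [chainProd_cons, h]
  simp only [F1term, Nat.add_sub_cancel]
  rw [← mul_assoc, div_mul_div_comm]

lemma summable_chainProd {q : ℝ} (hq0 : 0 < q) (hq1 : q < 1) (t d : ℕ) :
    Summable fun n : F1InnerIdx t d => chainProd q n.1 :=
  .of_norm_bounded
    ((summable_prod_apply (summable_geometric_of_lt_one hq0.le hq1)
      (fun n => pow_nonneg hq0.le n) (d + 1)).comp_injective Subtype.val_injective)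
    fun n => norm_chainProd_le hq0 hq1 n.pos

lemma summable_coeff_mul_chainProd {q : ℝ} (hq0 : 0 < q) (hq1 : q < 1) {d : ℕ} (D : ℕ) {s : ℂ}
    (hs : (d : ℝ) + 2 < s.re) :
    Summable fun x : Σ t : {t : ℕ // D < t}, F1InnerIdx t.1 d =>
      ((q : ℂ) ^ ((s - (d : ℂ) - 2) * (x.1.1 : ℂ)) / (qnum q x.1.1 : ℂ) ^ (s - (d : ℂ) - 1)) *
        chainProd q x.2.1 := by
  have hc : q ^ (s.re - d - 2) < 1 := Real.rpow_lt_one hq0.le hq1 (by linarith)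
  have hc0 : 0 ≤ q ^ (s.re - d - 2) := by positivity
  have hsum := (summable_geometric_of_lt_one hc0 hc).mul_of_nonneg
    (summable_prod_apply (summable_geometric_of_lt_one hq0.le hq1)
      (fun n => pow_nonneg hq0.le n) (d + 1))
    (fun t => pow_nonneg hc0 t) fun n => Finset.prod_nonneg fun i _ => pow_nonneg hq0.le _
  have hinj : Function.Injective
      fun x : Σ t : {t : ℕ // D < t}, F1InnerIdx t.1 d => (x.1.1, x.2.1) := by
    rintro ⟨⟨t, ht⟩, n, hn⟩ ⟨⟨t', ht'⟩, n', hn'⟩ h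
    obtain ⟨rfl, rfl⟩ := Prod.mk.inj h
    rfl
  refine .of_norm_bounded (hsum.comp_injective hinj) fun x => ?_
  rw [norm_mul]
  exact mul_le_mul (norm_coeff_le hq0 hq1 hs (Nat.zero_lt_of_lt x.1.2))
    (norm_chainProd_le hq0 hq1 x.2.pos) (norm_nonneg _) (pow_nonneg hc0 _)

/-- For `Re(s) > d + 2`,
`F_q^{(1)}(D;s;d) = Σ_{t>D} (q^{(s−d−2)t}/[t]_q^{s−d−1}) Σ_{0<n₀≤⋯≤n_d≤n₀+t}
q^{n₀+⋯+n_d}/([n₀]_q⋯[n_d]_q)`, all series converging absolutely. -/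
theorem F1_rewriting (q : ℝ) (hq0 : 0 < q) (hq1 : q < 1)
    (d D : ℕ) (hd : 1 ≤ d) (s : ℂ) (hs : (d : ℝ) + 2 < s.re) :
    Summable (fun p : FIdx D d => F1term q d s p.1) ∧
    (∀ t : ℕ, D < t → Summable (fun n : F1InnerIdx t d => chainProd q n.1)) ∧
    Summable (fun t : {t : ℕ // D < t} =>
      ((q : ℂ) ^ ((s - (d : ℂ) - 2) * (t.1 : ℂ)) / (qnum q t.1 : ℂ) ^ (s - (d : ℂ) - 1)) *
        ∑' n : F1InnerIdx t.1 d, chainProd q n.1) ∧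
    ∑' p : FIdx D d, F1term q d s p.1 =
      ∑' t : {t : ℕ // D < t},
        ((q : ℂ) ^ ((s - (d : ℂ) - 2) * (t.1 : ℂ)) / (qnum q t.1 : ℂ) ^ (s - (d : ℂ) - 1)) *
          ∑' n : F1InnerIdx t.1 d, chainProd q n.1 := by
  have hG := summable_coeff_mul_chainProd hq0 hq1 D hs
  refine ⟨?_, fun t _ => summable_chainProd hq0 hq1 t d, ?_, ?_⟩
  · rw [← (F1IdxEquiv D d).summable_iff]
    exact hG.congr fun x => (F1term_F1IdxEquiv q D d s x).symm
  · exact hG.sigma.congr fun t => by rw [← tsum_mul_left]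
  · rw [← (F1IdxEquiv D d).tsum_eq]
    simp only [F1term_F1IdxEquiv]
    rw [hG.tsum_sigma]
    exact tsum_congr fun t => by rw [← tsum_mul_left]
end
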